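/- Let p ≥ 3 and (β,h) be a p-special point with unique global maximizer m_* of H = H_{β,h,p}. If X ~ P_{β,h,p}, then as N → ∞, (S_N − N m_*)/N^{3/4} converges in distribution to the law F on ℝ with Lebesgue density dF(x) = (2/Γ(1/4)) (−H^{(4)}(m_*)/24)^{1/4} exp( H^{(4)}(m_*) x^4 / 24 ) dx. -/

import Mathlib

open Real MeasureTheory Filter
open scoped BigOperators Topology

noncomputable section

/-- The spin value (`±1`) of a Boolean coordinate. -/
def spin (b : Bool) : ℝ := if b then 1 else -1

/-- The total magnetization `S_N = ∑ᵢ Xᵢ` of a configuration. -/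
def mag {N : ℕ} (x : Fin N → Bool) : ℝ := ∑ i, spin (x i)

/-- The Hamiltonian of the `p`-spin Curie-Weiss model:
`β N^{1-p} ∑_{i₁,…,i_p} x_{i₁} ⋯ x_{i_p} + h ∑ᵢ xᵢ`. -/
def cwHamiltonian (p N : ℕ) (β h : ℝ) (x : Fin N → Bool) : ℝ :=
  β * (N : ℝ) ^ ((1 : ℤ) - (p : ℤ)) * (∑ i : Fin p → Fin N, ∏ j, spin (x (i j)))
    + h * mag x

/-- The (unnormalized) Gibbs weight of a configuration. -/
def cwWeight (p N : ℕ) (β h : ℝ) (x : Fin N → Bool) : ℝ :=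
  Real.exp (cwHamiltonian p N β h x)

/-- The probability of an event `E` under the `p`-spin Curie-Weiss measure `P_{β,h,p}`. -/
def cwProb (p N : ℕ) (β h : ℝ) (E : Set (Fin N → Bool)) : ℝ :=
  (∑ x : Fin N → Bool, E.indicator (cwWeight p N β h) x) /
    ∑ x : Fin N → Bool, cwWeight p N β h x

/-- Conditional probability of `E` given `A` under the `p`-spin Curie-Weiss measure. -/
def cwCondProb (p N : ℕ) (β h : ℝ) (E A : Set (Fin N → Bool)) : ℝ :=
  cwProb p N β h (E ∩ A) / cwProb p N β h A

/-- The binary entropy function `I(x) = ½[(1+x)log(1+x) + (1-x)log(1-x)]`. -/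
def binEnt (x : ℝ) : ℝ := (1/2) * ((1+x) * Real.log (1+x) + (1-x) * Real.log (1-x))

/-- The function `H_{β,h,p}(x) = βxᵖ + hx - I(x)`. -/
def Hfun (p : ℕ) (β h : ℝ) (x : ℝ) : ℝ := β * x ^ p + h * x - binEnt x

/-- `m` is a global maximizer of `H_{β,h,p}` on `[-1,1]`, lying in `(-1,1)`. -/
def isMaximizer (p : ℕ) (β h m : ℝ) : Prop :=
  m ∈ Set.Ioo (-1 : ℝ) 1 ∧ ∀ x ∈ Set.Icc (-1 : ℝ) 1, Hfun p β h x ≤ Hfun p β h m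

/-- `m` is the unique global maximizer of `H_{β,h,p}`. -/
def isUniqueMaximizer (p : ℕ) (β h m : ℝ) : Prop :=
  isMaximizer p β h m ∧ ∀ m', isMaximizer p β h m' → m' = m

/-- `(β,h)` is a `p`-regular point with unique global maximizer `m`. -/
def pRegular (p : ℕ) (β h m : ℝ) : Prop :=
  isUniqueMaximizer p β h m ∧ iteratedDeriv 2 (Hfun p β h) m < 0

/-- `(β,h)` is a `p`-special point with unique global maximizer `m`. -/
def pSpecial (p : ℕ) (β h m : ℝ) : Prop :=
  isUniqueMaximizer p β h m ∧ iteratedDeriv 2 (Hfun p β h) m = 0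

/-- `(β,h)` is a `p`-critical point: `H_{β,h,p}` has more than one global maximizer. -/
def pCritical (p : ℕ) (β h : ℝ) : Prop :=
  ∃ m₁ m₂, m₁ ≠ m₂ ∧ isMaximizer p β h m₁ ∧ isMaximizer p β h m₂

/-- The probability assigned to a set `S ⊆ ℝ` by the centered Gaussian with variance `v`. -/
def gaussProb (v : ℝ) (S : Set ℝ) : ℝ :=
  ∫ t in S, (Real.sqrt (2 * Real.pi * v))⁻¹ * Real.exp (-t ^ 2 / (2 * v))

/-- The CDF of the centered Gaussian with variance `v`. -/
def gaussCDF (v x : ℝ) : ℝ := gaussProb v (Set.Iic x)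

/-- The standard normal CDF `Φ`. -/
def stdNormCDF (x : ℝ) : ℝ := gaussCDF 1 x

/-- The CDF of the limit law `F` at a `p`-special point, where `c = H⁽⁴⁾(m_*)`:
`dF(x) = (2/Γ(1/4)) (-c/24)^{1/4} exp(c x⁴/24) dx`. -/
def specialCDF (c x : ℝ) : ℝ :=
  ∫ t in Set.Iic x, (2 / Real.Gamma (1/4)) * ((-c) / 24) ^ ((1:ℝ)/4) * Real.exp (c * t ^ 4 / 24)

/-- The inverse hyperbolic tangent `tanh⁻¹(t) = ½ log((1+t)/(1-t))`. -/
def arctanh (t : ℝ) : ℝ := (1/2) * Real.log ((1+t)/(1-t))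

/-- The function `g(t) = tanh⁻¹(t)/(p t^{p-1})`, so that the maximum pseudolikelihood
estimate of `β` is `g(X̄)`. -/
def gMPL (p : ℕ) (t : ℝ) : ℝ := arctanh t / (p * t ^ (p - 1))

/-- The threshold `β*(p) = inf{β ≥ 0 : sup_{x∈[0,1]} H_{β,0,p}(x) > 0}`. -/
def betaStar (p : ℕ) : ℝ := sInf {b : ℝ | 0 ≤ b ∧ ∃ x ∈ Set.Icc (0:ℝ) 1, 0 < Hfun p b 0 x}

lemma iteratedDeriv_eq_of_hasDerivAt_on {s : Set ℝ} (hs : IsOpen s) {f f' : ℝ → ℝ}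
    (n : ℕ) {g : ℝ → ℝ} (hf : ∀ x ∈ s, iteratedDeriv n f x = f' x)
    (hg : ∀ x ∈ s, HasDerivAt f' (g x) x) :
    ∀ x ∈ s, iteratedDeriv (n + 1) f x = g x := by
  intro x hx
  rw [iteratedDeriv_succ]
  have : iteratedDeriv n f =ᶠ[𝓝 x] f' := by
    filter_upwards [hs.mem_nhds hx] with y hy using hf y hy
  rw [this.deriv_eq, (hg x hx).deriv]

/-- The first derivative of `Hfun p β h` on `(-1, 1)`. -/
def Hderiv₁ (p : ℕ) (β h x : ℝ) : ℝ :=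
  β * (p * x ^ (p - 1)) + h - 1 / 2 * (Real.log (1 + x) - Real.log (1 - x))

/-- The second derivative of `Hfun p β h` on `(-1, 1)`. -/
def Hderiv₂ (p : ℕ) (β x : ℝ) : ℝ :=
  β * (p * ((p - 1 : ℕ) * x ^ (p - 1 - 1))) - (1 - x ^ 2)⁻¹

/-- The third derivative of `Hfun p β h` on `(-1, 1)`. -/
def Hderiv₃ (p : ℕ) (β x : ℝ) : ℝ :=
  β * (p * ((p - 1 : ℕ) * ((p - 1 - 1 : ℕ) * x ^ (p - 1 - 1 - 1)))) - 2 * x / (1 - x ^ 2) ^ 2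

/-- The fourth derivative of `Hfun p β h` on `(-1, 1)`. -/
def Hderiv₄ (p : ℕ) (β x : ℝ) : ℝ :=
  β * (p * ((p - 1 : ℕ) * ((p - 1 - 1 : ℕ) * ((p - 1 - 1 - 1 : ℕ) * x ^ (p - 1 - 1 - 1 - 1)))))
    - (2 + 6 * x ^ 2) / (1 - x ^ 2) ^ 3

lemma hasDerivAt_Hfun (p : ℕ) (β h : ℝ) {x : ℝ} (hx : x ∈ Set.Ioo (-1 : ℝ) 1) :
    HasDerivAt (Hfun p β h) (Hderiv₁ p β h x) x := by
  have h1 : 1 + x ≠ 0 := by linarith [hx.1]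
  have h2 : 1 - x ≠ 0 := by linarith [hx.2]
  have e1 : HasDerivAt (fun x : ℝ => 1 + x) 1 x := (hasDerivAt_id x).const_add 1
  have e2 : HasDerivAt (fun x : ℝ => 1 - x) (-1) x := (hasDerivAt_id x).const_sub 1
  have := ((((hasDerivAt_pow p x).const_mul β).add ((hasDerivAt_id x).const_mul h)).sub
    (((e1.mul (e1.log h1)).add (e2.mul (e2.log h2))).const_mul (1 / 2)))
  refine this.congr_deriv ?_
  unfold Hderiv₁
  field_simp
  ring

lemma hasDerivAt_Hderiv₁ (p : ℕ) (β h : ℝ) {x : ℝ} (hx : x ∈ Set.Ioo (-1 : ℝ) 1) :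
    HasDerivAt (Hderiv₁ p β h) (Hderiv₂ p β x) x := by
  have h1 : 1 + x ≠ 0 := by linarith [hx.1]
  have h2 : 1 - x ≠ 0 := by linarith [hx.2]
  have h3 : 1 - x ^ 2 ≠ 0 := by
    rw [show 1 - x ^ 2 = (1 + x) * (1 - x) by ring]; exact mul_ne_zero h1 h2
  have e1 : HasDerivAt (fun x : ℝ => 1 + x) 1 x := (hasDerivAt_id x).const_add 1
  have e2 : HasDerivAt (fun x : ℝ => 1 - x) (-1) x := (hasDerivAt_id x).const_sub 1
  have := ((((hasDerivAt_pow (p - 1) x).const_mul (p : ℝ)).const_mul β).add_const h).sub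
    (((e1.log h1).sub (e2.log h2)).const_mul (1 / 2))
  refine this.congr_deriv ?_
  unfold Hderiv₂
  congr 1
  rw [show 1 - x ^ 2 = (1 + x) * (1 - x) by ring]
  field_simp
  ring

lemma hasDerivAt_Hderiv₂ (p : ℕ) (β : ℝ) {x : ℝ} (hx : x ∈ Set.Ioo (-1 : ℝ) 1) :
    HasDerivAt (Hderiv₂ p β) (Hderiv₃ p β x) x := by
  have h3 : 1 - x ^ 2 ≠ 0 := by nlinarith [hx.1, hx.2]
  have e1 : HasDerivAt (fun x : ℝ => 1 - x ^ 2) (-(2 * x)) x := by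
    simpa using (hasDerivAt_pow 2 x).const_sub 1
  have := ((((hasDerivAt_pow (p - 1 - 1) x).const_mul ((p - 1 : ℕ) : ℝ)).const_mul
    (p : ℝ)).const_mul β).sub (e1.inv h3)
  refine this.congr_deriv ?_
  unfold Hderiv₃
  congr 1
  ring

lemma hasDerivAt_Hderiv₃ (p : ℕ) (β : ℝ) {x : ℝ} (hx : x ∈ Set.Ioo (-1 : ℝ) 1) :
    HasDerivAt (Hderiv₃ p β) (Hderiv₄ p β x) x := by
  have h3 : 1 - x ^ 2 ≠ 0 := by nlinarith [hx.1, hx.2]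
  have e1 : HasDerivAt (fun x : ℝ => (1 - x ^ 2) ^ 2) (2 * (1 - x ^ 2) * (-(2 * x))) x := by
    have : HasDerivAt (fun x : ℝ => 1 - x ^ 2) (-(2 * x)) x := by
      simpa using (hasDerivAt_pow 2 x).const_sub 1
    exact (this.pow 2).congr_deriv (by norm_num)
  have e2 : HasDerivAt (fun x : ℝ => 2 * x) 2 x := by
    simpa using (hasDerivAt_id x).const_mul 2
  have := (((((hasDerivAt_pow (p - 1 - 1 - 1) x).const_mul ((p - 1 - 1 : ℕ) : ℝ)).const_mul
    ((p - 1 : ℕ) : ℝ)).const_mul (p : ℝ)).const_mul β).sub (e2.div e1 (pow_ne_zero 2 h3))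
  refine this.congr_deriv ?_
  unfold Hderiv₄
  congr 1
  field_simp
  ring

lemma iteratedDeriv_Hfun (p : ℕ) (β h : ℝ) {x : ℝ} (hx : x ∈ Set.Ioo (-1 : ℝ) 1) :
    iteratedDeriv 2 (Hfun p β h) x = Hderiv₂ p β x ∧
      iteratedDeriv 4 (Hfun p β h) x = Hderiv₄ p β x := by
  have h0 : ∀ y ∈ Set.Ioo (-1 : ℝ) 1, iteratedDeriv 0 (Hfun p β h) y = Hfun p β h y := by simp
  have h1 := iteratedDeriv_eq_of_hasDerivAt_on isOpen_Ioo 0 h0 fun y => hasDerivAt_Hfun p β h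
  have h2 := iteratedDeriv_eq_of_hasDerivAt_on isOpen_Ioo 1 h1 fun y => hasDerivAt_Hderiv₁ p β h
  have h3 := iteratedDeriv_eq_of_hasDerivAt_on isOpen_Ioo 2 h2 fun y => hasDerivAt_Hderiv₂ p β
  have h4 := iteratedDeriv_eq_of_hasDerivAt_on isOpen_Ioo 3 h3 fun y => hasDerivAt_Hderiv₃ p β
  exact ⟨h2 x hx, h4 x hx⟩

lemma isLittleO_integrate {s : Set ℝ} (hs : IsOpen s) (hc : Convex ℝ s) {m : ℝ} (hm : m ∈ s)
    {f f' : ℝ → ℝ} (hf : ∀ x ∈ s, HasDerivAt f (f' x) x) (c : ℝ) (n : ℕ)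
    (ho : (fun x => f' x - c * (x - m) ^ n) =o[𝓝 m] fun x => (x - m) ^ n) :
    (fun x => f x - f m - c / (n + 1) * (x - m) ^ (n + 1)) =o[𝓝 m] fun x => (x - m) ^ (n + 1) := by
  rw [← hs.nhdsWithin_eq hm] at ho ⊢
  have hn : (n : ℝ) + 1 ≠ 0 := by positivity
  have key := hc.isLittleO_pow_succ_real hm
    (f := fun x => f x - c / (n + 1) * (x - m) ^ (n + 1)) (f' := fun x => f' x - c * (x - m) ^ n)
    (fun x hx => by
      have e : HasDerivAt (fun x => (x - m) ^ (n + 1)) ((n + 1) * (x - m) ^ n) x := by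
        simpa using ((hasDerivAt_id x).sub_const m).fun_pow (n + 1)
      refine (((hf x hx).sub (e.const_mul (c / (n + 1)))).congr_deriv ?_).hasDerivWithinAt
      field_simp) ho
  refine key.congr_left fun x => ?_
  simp
  ring

lemma Hfun_isLittleO_cube {p : ℕ} {β h m : ℝ} (hm : m ∈ Set.Ioo (-1 : ℝ) 1)
    (h1 : Hderiv₁ p β h m = 0) (h2 : Hderiv₂ p β m = 0) :
    (fun x => Hfun p β h x - Hfun p β h m - Hderiv₃ p β m / 6 * (x - m) ^ 3)
      =o[𝓝 m] fun x => (x - m) ^ 3 := by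
  have o1 : (fun x => Hderiv₂ p β x - Hderiv₃ p β m * (x - m) ^ 1)
      =o[𝓝 m] fun x => (x - m) ^ 1 := by
    refine ((hasDerivAt_iff_isLittleO.1 (hasDerivAt_Hderiv₂ p β hm)).congr (fun x => ?_) fun x => ?_)
    · simp only [h2, smul_eq_mul]; ring
    · simp
  have o2 := isLittleO_integrate isOpen_Ioo (convex_Ioo _ _) hm
    (fun x hx => hasDerivAt_Hderiv₁ p β h hx) _ 1 o1
  have o3 := isLittleO_integrate isOpen_Ioo (convex_Ioo _ _) hm
    (fun x hx => hasDerivAt_Hfun p β h hx) _ 2 (o2.congr_left fun x => by rw [h1, sub_zero])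
  refine o3.congr_left fun x => ?_
  push_cast
  ring

lemma Hfun_isLittleO_four {p : ℕ} {β h m : ℝ} (hm : m ∈ Set.Ioo (-1 : ℝ) 1)
    (h1 : Hderiv₁ p β h m = 0) (h2 : Hderiv₂ p β m = 0) (h3 : Hderiv₃ p β m = 0) :
    (fun x => Hfun p β h x - Hfun p β h m - Hderiv₄ p β m / 24 * (x - m) ^ 4)
      =o[𝓝 m] fun x => (x - m) ^ 4 := by
  have o1 : (fun x => Hderiv₃ p β x - Hderiv₄ p β m * (x - m) ^ 1)
      =o[𝓝 m] fun x => (x - m) ^ 1 := by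
    refine ((hasDerivAt_iff_isLittleO.1 (hasDerivAt_Hderiv₃ p β hm)).congr (fun x => ?_) fun x => ?_)
    · simp only [h3, smul_eq_mul]; ring
    · simp
  have o2 := isLittleO_integrate isOpen_Ioo (convex_Ioo _ _) hm
    (fun x hx => hasDerivAt_Hderiv₂ p β hx) _ 1 o1
  have o3 := isLittleO_integrate isOpen_Ioo (convex_Ioo _ _) hm
    (fun x hx => hasDerivAt_Hderiv₁ p β h hx) _ 2 (o2.congr_left fun x => by rw [h2, sub_zero])
  have o4 := isLittleO_integrate isOpen_Ioo (convex_Ioo _ _) hm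
    (fun x hx => hasDerivAt_Hfun p β h hx) _ 3 (o3.congr_left fun x => by rw [h1, sub_zero])
  refine o4.congr_left fun x => ?_
  push_cast
  ring

lemma eq_zero_of_isLittleO_cube {f : ℝ → ℝ} {m a : ℝ} (hmax : ∀ᶠ x in 𝓝 m, f x ≤ f m)
    (ho : (fun x => f x - f m - a * (x - m) ^ 3) =o[𝓝 m] fun x => (x - m) ^ 3) : a = 0 := by
  by_contra ha
  have hev := (ho.bound (half_pos (abs_pos.2 ha))).and hmax
  obtain ⟨ε, hε, hb⟩ := Metric.eventually_nhds_iff.1 hev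
  rcases lt_or_gt_of_ne ha with ha' | ha'
  · obtain ⟨hb1, hb2⟩ := @hb (m - ε / 2) (by rw [Real.dist_eq, abs_lt]; constructor <;> linarith)
    have e : (m - ε / 2 - m) ^ 3 = - (ε / 2) ^ 3 := by ring
    have hp : 0 < (ε / 2) ^ 3 := by positivity
    rw [e, Real.norm_eq_abs, Real.norm_eq_abs, abs_neg, abs_of_pos hp, abs_of_neg ha'] at hb1
    have := (abs_le.1 hb1).1
    nlinarith [mul_pos (neg_pos.2 ha') hp]
  · obtain ⟨hb1, hb2⟩ := @hb (m + ε / 2) (by rw [Real.dist_eq, abs_lt]; constructor <;> linarith)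
    have e : (m + ε / 2 - m) ^ 3 = (ε / 2) ^ 3 := by ring
    have hp : 0 < (ε / 2) ^ 3 := by positivity
    rw [e, Real.norm_eq_abs, Real.norm_eq_abs, abs_of_pos hp, abs_of_pos ha'] at hb1
    have := (abs_le.1 hb1).1
    nlinarith [mul_pos ha' hp]

lemma isMaximizer.derivs {p : ℕ} {β h m : ℝ} (hmax : isMaximizer p β h m)
    (h2 : Hderiv₂ p β m = 0) : Hderiv₁ p β h m = 0 ∧ Hderiv₃ p β m = 0 := by
  have hev : ∀ᶠ x in 𝓝 m, Hfun p β h x ≤ Hfun p β h m := by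
    filter_upwards [isOpen_Ioo.mem_nhds hmax.1] with x hx using
      hmax.2 x (Set.Ioo_subset_Icc_self hx)
  have h1 : Hderiv₁ p β h m = 0 :=
    IsLocalMax.hasDerivAt_eq_zero hev (hasDerivAt_Hfun p β h hmax.1)
  refine ⟨h1, ?_⟩
  have := eq_zero_of_isLittleO_cube hev (Hfun_isLittleO_cube hmax.1 h1 h2)
  linarith

lemma Hderiv₄_neg {p : ℕ} (hp : 3 ≤ p) {β m : ℝ} (hm : m ∈ Set.Ioo (-1 : ℝ) 1)
    (h2 : Hderiv₂ p β m = 0) (h3 : Hderiv₃ p β m = 0) : Hderiv₄ p β m < 0 := by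
  obtain ⟨q, rfl⟩ := Nat.exists_eq_add_of_le' hp
  have hD : 0 < 1 - m ^ 2 := by nlinarith [hm.1, hm.2]
  have hm0 : m ≠ 0 := by
    rintro rfl
    simp [Hderiv₂] at h2
  set A := (1 - m ^ 2)⁻¹ with hA
  have hA0 : 0 < A := inv_pos.2 hD
  have hAD : A * (1 - m ^ 2) = 1 := inv_mul_cancel₀ hD.ne'
  set B := β * ((q + 3) * (q + 2)) with hB
  have e2 : B * m ^ (q + 1) = A := by
    simp only [Hderiv₂, Nat.add_succ_sub_one] at h2
    push_cast at h2
    linear_combination h2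
  have e3 : B * ((q + 1) * m ^ q) = 2 * m * A ^ 2 := by
    have : 2 * m / (1 - m ^ 2) ^ 2 = 2 * m * A ^ 2 := by rw [hA]; field_simp
    simp only [Hderiv₃, Nat.add_succ_sub_one, Nat.add_sub_cancel, this] at h3
    push_cast at h3
    linear_combination h3
  have e4 : Hderiv₄ (q + 3) β m =
      B * ((q + 1) * (q * m ^ (q - 1))) - (2 + 6 * m ^ 2) * A ^ 3 := by
    have : (2 + 6 * m ^ 2) / (1 - m ^ 2) ^ 3 = (2 + 6 * m ^ 2) * A ^ 3 := by rw [hA]; field_simp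
    simp only [Hderiv₄, Nat.add_succ_sub_one, Nat.add_sub_cancel, this]
    push_cast
    ring
  have f1 : (q + 1 : ℝ) = 2 * m ^ 2 * A := by
    have : (q + 1 : ℝ) * A = (2 * m ^ 2 * A) * A := by
      rw [pow_succ] at e2
      linear_combination m * e3 - (q + 1 : ℝ) * e2
    exact mul_right_cancel₀ hA0.ne' this
  have f2 : (q : ℝ) * m ^ (q - 1) * m = q * m ^ q := by
    rcases q with _ | q
    · simp
    · simp [pow_succ]; ring
  have f3 : B * ((q + 1) * (q * m ^ (q - 1))) = 2 * A ^ 2 * q := by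
    apply mul_right_cancel₀ hm0
    linear_combination B * (q + 1) * f2 + q * e3
  have f4 : Hderiv₄ (q + 3) β m = -4 * A ^ 3 := by
    rw [e4, f3]
    linear_combination 2 * A ^ 2 * f1 + 2 * A ^ 2 * hAD
  rw [f4]
  have : 0 < A ^ 3 := by positivity
  linarith

lemma continuous_Hfun (p : ℕ) (β h : ℝ) : Continuous (Hfun p β h) := by
  have h1 : Continuous fun x : ℝ => (1 + x) * Real.log (1 + x) :=
    Real.continuous_mul_log.comp (continuous_const.add continuous_id)
  have h2 : Continuous fun x : ℝ => (1 - x) * Real.log (1 - x) :=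
    Real.continuous_mul_log.comp (continuous_const.sub continuous_id)
  unfold Hfun binEnt
  fun_prop

lemma exists_Hfun_one_lt (p : ℕ) {β : ℝ} (h : ℝ) (hβ : 0 < β) :
    ∃ x ∈ Set.Ioo (-1 : ℝ) 1, Hfun p β h 1 < Hfun p β h x := by
  set c := 2 * (β * p + |h| + 1) with hc
  have hc0 : 0 < c := by positivity
  set x := 1 - Real.exp (-c) with hx
  have he1 : Real.exp (-c) < 1 := by simpa using hc0
  have he0 := Real.exp_pos (-c)
  refine ⟨x, ⟨by linarith, by linarith⟩, ?_⟩
  obtain ⟨ξ, hξ, hξ'⟩ := exists_hasDerivAt_eq_slope (Hfun p β h) (Hderiv₁ p β h)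
    (show x < 1 by linarith) (continuous_Hfun p β h).continuousOn
    (fun y hy => hasDerivAt_Hfun p β h ⟨by linarith [hy.1], hy.2⟩)
  have hξ0 : 0 < ξ := by linarith [hξ.1]
  have hneg : Hderiv₁ p β h ξ < 0 := by
    have l1 : 0 ≤ Real.log (1 + ξ) := Real.log_nonneg (by linarith)
    have l2 : Real.log (1 - ξ) ≤ -c := by
      rw [Real.log_le_iff_le_exp (by linarith [hξ.2])]
      linarith [hξ.1]
    have l3 : (p : ℝ) * ξ ^ (p - 1) ≤ p * 1 := by
      gcongr
      exact pow_le_one₀ hξ0.le hξ.2.le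
    have l4 : β * ((p : ℝ) * ξ ^ (p - 1)) ≤ β * p := by
      rw [mul_one] at l3
      gcongr
    unfold Hderiv₁
    linarith [le_abs_self h]
  rw [hξ', div_neg_iff] at hneg
  rcases hneg with hneg | hneg <;> linarith [hneg.1, hneg.2]

lemma Hfun_neg_one_lt (p : ℕ) {β h : ℝ} (hβ : 0 < β) (hh : 0 < h) :
    Hfun p β h (-1) < Hfun p β h 1 := by
  have : (-1 : ℝ) ^ p ≤ 1 := (le_abs_self _).trans (by simp)
  have : β * (-1 : ℝ) ^ p ≤ β * 1 := by gcongr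
  simp [Hfun, binEnt]
  linarith

lemma isUniqueMaximizer.lt {p : ℕ} {β h m : ℝ} (hβ : 0 < β) (hh : 0 < h)
    (hm : isUniqueMaximizer p β h m) {x : ℝ} (hx : x ∈ Set.Icc (-1 : ℝ) 1) (hxm : x ≠ m) :
    Hfun p β h x < Hfun p β h m := by
  have h1 : Hfun p β h 1 < Hfun p β h m := by
    obtain ⟨y, hy, hy'⟩ := exists_Hfun_one_lt p h hβ
    exact hy'.trans_le (hm.1.2 y (Set.Ioo_subset_Icc_self hy))
  refine lt_of_le_of_ne (hm.1.2 x hx) fun heq => hxm (hm.2 x ⟨⟨?_, ?_⟩, fun y hy => ?_⟩)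
  · refine lt_of_le_of_ne hx.1 fun e => ?_
    subst e
    linarith [Hfun_neg_one_lt p hβ hh]
  · refine lt_of_le_of_ne hx.2 fun e => ?_
    subst e
    linarith
  · rw [heq]
    exact hm.1.2 y hy

lemma exists_quartic_bound {f : ℝ → ℝ} {m c : ℝ} (hf : Continuous f)
    (hm : m ∈ Set.Icc (-1 : ℝ) 1) (hlt : ∀ x ∈ Set.Icc (-1 : ℝ) 1, x ≠ m → f x < f m)
    (hc : c < 0)
    (ho : (fun x => f x - f m - c * (x - m) ^ 4) =o[𝓝 m] fun x => (x - m) ^ 4) :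
    ∃ δ > 0, ∀ x ∈ Set.Icc (-1 : ℝ) 1, f x - f m ≤ -δ * (x - m) ^ 4 := by
  obtain ⟨ε, hε, hb⟩ := Metric.eventually_nhds_iff.1 (ho.bound (show 0 < -c / 2 by linarith))
  have h4 : ∀ x : ℝ, 0 ≤ (x - m) ^ 4 := fun x => by positivity
  have hloc : ∀ x, |x - m| < ε → f x - f m ≤ -(-c / 2) * (x - m) ^ 4 := by
    intro x hx
    have := @hb x hx
    rw [Real.norm_eq_abs, Real.norm_eq_abs, abs_of_nonneg (h4 x)] at this
    linarith [(abs_le.1 this).2]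
  have hK : IsCompact (Set.Icc (-1 : ℝ) 1 ∩ {x | ε ≤ |x - m|}) :=
    isCompact_Icc.inter_right (isClosed_le continuous_const (by fun_prop))
  have hfar : ∃ η > 0, ∀ x ∈ Set.Icc (-1 : ℝ) 1, ε ≤ |x - m| → f x - f m ≤ -η := by
    rcases Set.eq_empty_or_nonempty (Set.Icc (-1 : ℝ) 1 ∩ {x | ε ≤ |x - m|}) with he | hne
    · exact ⟨1, one_pos, fun x hx hxm => absurd (he ▸ ⟨hx, hxm⟩ : x ∈ (∅ : Set ℝ)) (by simp)⟩
    · obtain ⟨y, ⟨hy, hym⟩, hmax⟩ := hK.exists_isMaxOn hne hf.continuousOn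
      have hy' : y ≠ m := by
        rintro rfl
        simp at hym
        linarith
      refine ⟨f m - f y, sub_pos.2 (hlt y hy hy'), fun x hx hxm => ?_⟩
      have : f x ≤ f y := hmax ⟨hx, hxm⟩
      linarith
  obtain ⟨η, hη, hfar⟩ := hfar
  refine ⟨min (-c / 2) (η / 16), lt_min (by linarith) (by positivity), fun x hx => ?_⟩
  rcases lt_or_ge |x - m| ε with hxm | hxm
  · refine (hloc x hxm).trans ?_
    nlinarith [min_le_left (-c / 2) (η / 16), h4 x]
  · refine (hfar x hx hxm).trans ?_
    have h16 : (x - m) ^ 4 ≤ 16 := by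
      have : |x - m| ≤ 2 := abs_le.2 ⟨by linarith [hx.1, hm.2], by linarith [hx.2, hm.1]⟩
      calc (x - m) ^ 4 = |x - m| ^ 4 := by rw [Even.pow_abs (by decide)]
        _ ≤ 2 ^ 4 := by gcongr
        _ = 16 := by norm_num
    have h0 : 0 < min (-c / 2) (η / 16) := lt_min (by linarith) (by positivity)
    nlinarith [min_le_right (-c / 2) (η / 16), h4 x]

lemma mag_eq_card {N : ℕ} (σ : Fin N → Bool) :
    mag σ = 2 * ((Finset.univ.filter fun i => σ i = true).card : ℝ) - N := by
  have h1 : ∀ b : Bool, spin b = 2 * (if b = true then 1 else 0) - 1 := by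
    intro b; cases b <;> norm_num [spin]
  simp only [mag, h1, Finset.sum_sub_distrib, ← Finset.mul_sum]
  simp

lemma sum_comp_mag (N : ℕ) (g : ℝ → ℝ) :
    ∑ σ : Fin N → Bool, g (mag σ) =
      ∑ k ∈ Finset.range (N + 1), (N.choose k : ℝ) * g (2 * k - N) := by
  have h := Finset.sum_powerset_apply_card (fun k : ℕ => g (2 * k - N))
    (x := (Finset.univ : Finset (Fin N)))
  simp only [Finset.card_univ, Fintype.card_fin, nsmul_eq_mul] at h
  rw [← h, Finset.powerset_univ]
  refine Finset.sum_bij' (fun σ _ => Finset.univ.filter fun i => σ i = true)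
    (fun s _ i => decide (i ∈ s)) (by simp) (by simp) ?_ ?_ ?_
  · intro σ _; ext i; simp
  · intro s _; ext i; simp
  · intro σ _; rw [mag_eq_card]

lemma cwWeight_eq {p N : ℕ} (hN : N ≠ 0) (β h : ℝ) (σ : Fin N → Bool) :
    cwWeight p N β h σ = Real.exp (N * (β * (mag σ / N) ^ p + h * (mag σ / N))) := by
  have hN' : (N : ℝ) ≠ 0 := Nat.cast_ne_zero.2 hN
  have h1 : ∑ i : Fin p → Fin N, ∏ j, spin (σ (i j)) = mag σ ^ p := by
    rw [← Fintype.prod_sum fun (_ : Fin p) (i : Fin N) => spin (σ i)]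
    simp [mag]
  rw [cwWeight, cwHamiltonian, h1, zpow_sub₀ hN', zpow_one, zpow_natCast, div_pow]
  congr 1
  field_simp

/-- The binomial probability of `k` successes out of `N` with success probability `k / N`. -/
def binPmf (N k : ℕ) : ℝ :=
  N.choose k * ((k : ℝ) / N) ^ k * (1 - (k : ℝ) / N) ^ (N - k)

lemma exp_mul_log_of_nat (k : ℕ) {y : ℝ} (hy : 0 < k → 0 < y) :
    Real.exp (k * Real.log y) = y ^ k := by
  rcases Nat.eq_zero_or_pos k with rfl | hk
  · simp
  · rw [← Real.log_pow, Real.exp_log (pow_pos (hy hk) k)]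

lemma exp_mul_binEnt {N k : ℕ} (hN : N ≠ 0) (hk : k ≤ N) :
    Real.exp (N * binEnt ((2 * k - N) / N)) =
      2 ^ N * (((k : ℝ) / N) ^ k * (1 - (k : ℝ) / N) ^ (N - k)) := by
  have hN' : (0 : ℝ) < N := by positivity
  have e1 : 1 + (2 * (k : ℝ) - N) / N = 2 * (k / N) := by field_simp; ring
  have e2 : 1 - (2 * (k : ℝ) - N) / N = 2 * (1 - k / N) := by field_simp; ring
  have e3 : (N : ℝ) * binEnt ((2 * k - N) / N) =
      k * Real.log (2 * (k / N)) + ((N - k : ℕ) : ℝ) * Real.log (2 * (1 - k / N)) := by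
    rw [binEnt, e1, e2, Nat.cast_sub hk]
    field_simp
  rw [e3, Real.exp_add, exp_mul_log_of_nat, exp_mul_log_of_nat, mul_pow, mul_pow]
  · rw [show (2 : ℝ) ^ N = 2 ^ k * 2 ^ (N - k) by rw [← pow_add, Nat.add_sub_cancel' hk]]
    ring
  · intro h
    have : (k : ℝ) < N := by exact_mod_cast (by omega : k < N)
    have : (k : ℝ) / N < 1 := (div_lt_one hN').2 this
    linarith
  · intro h
    positivity

lemma choose_mul_exp {N k : ℕ} (hN : N ≠ 0) (hk : k ≤ N) (p : ℕ) (β h : ℝ) :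
    (N.choose k : ℝ) * Real.exp (N * (β * ((2 * k - N) / N) ^ p + h * ((2 * k - N) / N))) =
      2 ^ N * binPmf N k * Real.exp (N * Hfun p β h ((2 * k - N) / N)) := by
  have e : (N : ℝ) * (β * ((2 * k - N) / N) ^ p + h * ((2 * k - N) / N)) =
      N * Hfun p β h ((2 * k - N) / N) + N * binEnt ((2 * k - N) / N) := by
    unfold Hfun; ring
  rw [e, Real.exp_add, exp_mul_binEnt hN hk, binPmf]
  ring

lemma sum_mul_cwWeight {p N : ℕ} (hN : N ≠ 0) (β h : ℝ) (χ : ℝ → ℝ) :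
    ∑ σ : Fin N → Bool, χ (mag σ) * cwWeight p N β h σ =
      ∑ k ∈ Finset.range (N + 1), 2 ^ N * binPmf N k *
        Real.exp (N * Hfun p β h ((2 * k - N) / N)) * χ (2 * k - N) := by
  simp only [cwWeight_eq hN]
  rw [sum_comp_mag N fun s => χ s * Real.exp (N * (β * (s / N) ^ p + h * (s / N)))]
  refine Finset.sum_congr rfl fun k hk => ?_
  rw [← choose_mul_exp hN (Nat.lt_succ_iff.1 (Finset.mem_range.1 hk))]
  ring

lemma binPmf_nonneg {N k : ℕ} (hk : k ≤ N) : 0 ≤ binPmf N k := by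
  have : (k : ℝ) / N ≤ 1 := div_le_one_of_le₀ (by exact_mod_cast hk) (by positivity)
  have : 0 ≤ 1 - (k : ℝ) / N := by linarith
  unfold binPmf
  positivity

lemma binPmf_le_one {N k : ℕ} (hk : k ≤ N) : binPmf N k ≤ 1 := by
  have : (k : ℝ) / N ≤ 1 := div_le_one_of_le₀ (by exact_mod_cast hk) (by positivity)
  have h0 : 0 ≤ 1 - (k : ℝ) / N := by linarith
  have h := add_pow ((k : ℝ) / N) (1 - k / N) N
  rw [add_sub_cancel, one_pow] at h
  rw [h, binPmf, show (N.choose k : ℝ) * (k / N) ^ k * (1 - (k : ℝ) / N) ^ (N - k) =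
    ((k : ℝ) / N) ^ k * (1 - k / N) ^ (N - k) * N.choose k by ring]
  exact Finset.single_le_sum
    (f := fun j => ((k : ℝ) / N) ^ j * (1 - (k : ℝ) / N) ^ (N - j) * N.choose j)
    (fun j _ => by positivity) (Finset.mem_range.2 (Nat.lt_succ_of_le hk))

lemma factorial_eq_stirlingSeq {n : ℕ} (hn : n ≠ 0) :
    (n.factorial : ℝ) = Stirling.stirlingSeq n * (√(2 * n) * (n / Real.exp 1) ^ n) := by
  have : (0 : ℝ) < n := by positivity
  rw [Stirling.stirlingSeq, div_mul_cancel₀]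
  positivity

lemma sqrt_mul_binPmf {N k : ℕ} (hk : 0 < k) (hkN : k < N) :
    √N * binPmf N k = Stirling.stirlingSeq N /
      (Stirling.stirlingSeq k * Stirling.stirlingSeq (N - k)) /
        √(2 * ((k : ℝ) / N) * (1 - k / N)) := by
  obtain ⟨l, rfl⟩ := Nat.exists_eq_add_of_lt hkN
  set j := l + 1 with hj
  have hN : k + l + 1 = k + j := by omega
  rw [hN]
  have hj0 : 0 < j := by omega
  have hkr : (0 : ℝ) < k := by positivity
  have hjr : (0 : ℝ) < j := by positivity
  have hsk : 0 < Stirling.stirlingSeq k :=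
    (Real.sqrt_pos.2 Real.pi_pos).trans_le (Stirling.sqrt_pi_le_stirlingSeq hk.ne')
  have hsj : 0 < Stirling.stirlingSeq j :=
    (Real.sqrt_pos.2 Real.pi_pos).trans_le (Stirling.sqrt_pi_le_stirlingSeq hj0.ne')
  have e1 : 1 - (k : ℝ) / (k + j : ℕ) = j / (k + j) := by push_cast; field_simp; ring
  rw [binPmf, e1, Nat.add_sub_cancel_left, Nat.cast_add_choose,
    factorial_eq_stirlingSeq (n := k) hk.ne', factorial_eq_stirlingSeq (n := j) hj0.ne',
    factorial_eq_stirlingSeq (n := k + j) (by omega)]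
  push_cast
  have hnr : (0 : ℝ) < k + j := by positivity
  have hroot : √(2 * ((k : ℝ) / (k + j)) * (j / (k + j))) =
      √(2 * k) * √(2 * j) / (√(2 * (k + j)) * √(k + j)) := by
    rw [← Real.sqrt_mul (by positivity), ← Real.sqrt_mul (by positivity),
      ← Real.sqrt_div (by positivity)]
    congr 1
    field_simp
  rw [hroot]
  have h1 : 0 < √(2 * (k : ℝ)) := by positivity
  have h2 : 0 < √(2 * (j : ℝ)) := by positivity
  have h3 : 0 < √(2 * ((k : ℝ) + j)) := by positivity
  have h4 : 0 < √((k : ℝ) + j) := by positivity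
  have he := Real.exp_pos 1
  simp only [div_pow, pow_add]
  field_simp

lemma stirlingSeq_le {n : ℕ} : Stirling.stirlingSeq n ≤ Stirling.stirlingSeq 1 := by
  rcases n with _ | n
  · rw [Stirling.stirlingSeq_zero, Stirling.stirlingSeq_one]; positivity
  · exact Stirling.stirlingSeq'_antitone (Nat.zero_le n)

lemma sqrt_mul_binPmf_le {κ : ℝ} (hκ : 0 < κ) :
    ∃ C, 0 < C ∧ ∀ N k : ℕ, 0 < N → κ ≤ (k : ℝ) / N → κ ≤ 1 - (k : ℝ) / N →
      √N * binPmf N k ≤ C := by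
  have hπ := Real.sqrt_pos.2 Real.pi_pos
  have h1 : 0 < Stirling.stirlingSeq 1 := Stirling.stirlingSeq'_pos 0
  refine ⟨Stirling.stirlingSeq 1 / (√π * √π) / √(2 * κ * κ), by positivity,
    fun N k hN h2 h3 => ?_⟩
  have hNr : (0 : ℝ) < N := by positivity
  have hk : 0 < k := by
    rcases Nat.eq_zero_or_pos k with rfl | hk
    · simp at h2; linarith
    · exact hk
  have hkN : k < N := by
    have : (k : ℝ) / N < 1 := by linarith
    rw [div_lt_one hNr] at this
    exact_mod_cast this
  rw [sqrt_mul_binPmf hk hkN]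
  have h4 := Stirling.sqrt_pi_le_stirlingSeq hk.ne'
  have h5 : √π ≤ Stirling.stirlingSeq (N - k) := Stirling.sqrt_pi_le_stirlingSeq (by omega)
  have h6 := hπ.le.trans h4
  have h7 : Stirling.stirlingSeq N ≤ Stirling.stirlingSeq 1 := stirlingSeq_le
  gcongr

lemma tendsto_sqrt_mul_binPmf {α : ℝ} (hα : α ∈ Set.Ioo (0 : ℝ) 1) {k : ℕ → ℕ}
    (hk : Tendsto (fun N => (k N : ℝ) / N) atTop (𝓝 α)) :
    Tendsto (fun N : ℕ => √N * binPmf N (k N)) atTop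
      (𝓝 (√π / (√π * √π) / √(2 * α * (1 - α)))) := by
  have hπ := Real.sqrt_pos.2 Real.pi_pos
  have hα0 := hα.1
  have hα1 : 0 < 1 - α := by linarith [hα.2]
  have hev : ∀ᶠ N : ℕ in atTop, 0 < N ∧ 0 < k N ∧ k N < N := by
    filter_upwards [hk.eventually (isOpen_Ioo.mem_nhds hα), eventually_gt_atTop 0] with N h hN
    have hNr : (0 : ℝ) < N := by positivity
    refine ⟨hN, ?_, ?_⟩
    · rcases Nat.eq_zero_or_pos (k N) with h0 | h0
      · simp [h0] at h
      · exact h0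
    · have := h.2
      rw [div_lt_one hNr] at this
      exact_mod_cast this
  have hkt : Tendsto k atTop atTop := by
    rw [← tendsto_natCast_atTop_iff (R := ℝ)]
    refine (hk.pos_mul_atTop hα0 tendsto_natCast_atTop_atTop).congr' ?_
    filter_upwards [eventually_gt_atTop 0] with N hN
    field_simp
  have hk' : Tendsto (fun N : ℕ => 1 - (k N : ℝ) / N) atTop (𝓝 (1 - α)) := hk.const_sub 1
  have hlt : Tendsto (fun N => N - k N) atTop atTop := by
    rw [← tendsto_natCast_atTop_iff (R := ℝ)]
    refine (hk'.pos_mul_atTop hα1 tendsto_natCast_atTop_atTop).congr' ?_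
    filter_upwards [hev] with N hN
    rw [Nat.cast_sub hN.2.2.le]
    have : (0 : ℝ) < N := by exact_mod_cast hN.1
    field_simp
  have hS := Stirling.tendsto_stirlingSeq_sqrt_pi
  have hden : √(2 * α * (1 - α)) ≠ 0 := by positivity
  refine ((hS.div ((hS.comp hkt).mul (hS.comp hlt)) (by positivity)).div
    (((hk.const_mul 2).mul hk').sqrt) hden).congr' ?_
  filter_upwards [hev] with N hN
  rw [sqrt_mul_binPmf hN.2.1 hN.2.2]
  rfl

/-- The step function on `[0, N + 1)` with value `a k` on `[k, k + 1)`. -/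
def stepFn (N : ℕ) (a : ℕ → ℝ) (u : ℝ) : ℝ :=
  ∑ k ∈ Finset.range (N + 1), (Set.Ico (k : ℝ) (k + 1)).indicator (fun _ => a k) u

lemma measurable_stepFn (N : ℕ) (a : ℕ → ℝ) : Measurable (stepFn N a) := by
  unfold stepFn
  exact Finset.measurable_fun_sum _ fun k _ => measurable_const.indicator measurableSet_Ico

lemma integral_stepFn_comp (N : ℕ) (a : ℕ → ℝ) {c : ℝ} (hc : 0 < c) (d : ℝ) :
    ∫ t, stepFn N a (c * t + d) = c⁻¹ * ∑ k ∈ Finset.range (N + 1), a k := by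
  rw [Measure.integral_comp_mul_left (fun u => stepFn N a (u + d)),
    integral_add_right_eq_self, abs_of_pos (inv_pos.2 hc), smul_eq_mul]
  congr 1
  unfold stepFn
  rw [integral_finsetSum]
  · refine Finset.sum_congr rfl fun k _ => ?_
    rw [integral_indicator measurableSet_Ico]
    simp
  · intro k _
    rw [integrable_indicator_iff measurableSet_Ico]
    exact integrableOn_const (by simp)

lemma stepFn_floor {N : ℕ} (a : ℕ → ℝ) {u : ℝ} (h0 : 0 ≤ u) (hN : ⌊u⌋₊ ≤ N) :
    stepFn N a u = a ⌊u⌋₊ := by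
  unfold stepFn
  rw [Finset.sum_eq_single ⌊u⌋₊]
  · rw [Set.indicator_of_mem]
    exact ⟨Nat.floor_le h0, Nat.lt_floor_add_one u⟩
  · intro k _ hk
    refine Set.indicator_of_notMem (fun h => hk ?_) _
    exact ((Nat.floor_eq_iff h0).2 h).symm
  · intro h
    exact absurd (Finset.mem_range.2 (Nat.lt_succ_of_le hN)) h

lemma abs_stepFn_le {N : ℕ} {a : ℕ → ℝ} {u B : ℝ} (hB : 0 ≤ B)
    (h : ∀ k ≤ N, (k : ℝ) ≤ u → u < k + 1 → |a k| ≤ B) : |stepFn N a u| ≤ B := by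
  by_cases hu : 0 ≤ u ∧ ⌊u⌋₊ ≤ N
  · rw [stepFn_floor a hu.1 hu.2]
    exact h _ hu.2 (Nat.floor_le hu.1) (Nat.lt_floor_add_one u)
  · have : stepFn N a u = 0 := by
      refine Finset.sum_eq_zero fun k hk => Set.indicator_of_notMem (fun hk' => hu ?_) _
      have h0 : 0 ≤ u := (Nat.cast_nonneg k).trans hk'.1
      refine ⟨h0, ?_⟩
      rw [(Nat.floor_eq_iff h0).2 hk']
      exact Nat.lt_succ_iff.1 (Finset.mem_range.1 hk)
    rwa [this, abs_zero]

lemma integral_exp_neg_mul_four {b : ℝ} (hb : 0 < b) :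
    ∫ t : ℝ, Real.exp (-b * t ^ 4) = b ^ (-(1 / 4) : ℝ) * (Real.Gamma (1 / 4) / 2) := by
  have h1 : ∫ t : ℝ, Real.exp (-b * t ^ 4) = ∫ t : ℝ, Real.exp (-b * |t| ^ 4) := by
    congr 1; ext t; rw [Even.pow_abs (by decide)]
  rw [h1, integral_comp_abs (f := fun t => Real.exp (-b * t ^ 4))]
  have h2 := integral_exp_neg_mul_rpow (p := 4) (b := b) (by norm_num) hb
  have h3 : ∫ t in Set.Ioi (0 : ℝ), Real.exp (-b * t ^ 4) =
      ∫ t in Set.Ioi (0 : ℝ), Real.exp (-b * t ^ (4 : ℝ)) := by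
    refine setIntegral_congr_fun measurableSet_Ioi fun t _ => ?_
    norm_cast
  rw [h3, h2, Real.Gamma_add_one (by norm_num)]
  rw [show (-1 / 4 : ℝ) = -(1 / 4) by norm_num]
  ring

lemma integral_exp_neg_mul_four_pos {b : ℝ} (hb : 0 < b) :
    0 < ∫ t : ℝ, Real.exp (-b * t ^ 4) := by
  rw [integral_exp_neg_mul_four hb]
  have := Real.Gamma_pos_of_pos (show (0 : ℝ) < 1 / 4 by norm_num)
  positivity

lemma integrable_exp_neg_mul_four {b : ℝ} (hb : 0 < b) :
    Integrable fun t : ℝ => Real.exp (-b * t ^ 4) :=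
  not_imp_comm.1 integral_undef (integral_exp_neg_mul_four_pos hb).ne'

/-- The value of `(S_N - N m) / N ^ (3 / 4)` when exactly `k` spins are positive. -/
def latticePt (m : ℝ) (N k : ℕ) : ℝ := (2 * k - N - N * m) / (N : ℝ) ^ ((3 : ℝ) / 4)

/-- The total Gibbs weight of the configurations with `k` positive spins, normalized by
`√N / (2 ^ N * exp (N * H m))`. -/
def levelWeight (p : ℕ) (β h m : ℝ) (N k : ℕ) : ℝ :=
  √N * binPmf N k * Real.exp (N * (Hfun p β h ((2 * k - N) / N) - Hfun p β h m))

lemma rpow_three_quarters_pow_four (N : ℕ) : ((N : ℝ) ^ ((3 : ℝ) / 4)) ^ 4 = (N : ℝ) ^ 3 := by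
  rw [← Real.rpow_natCast, ← Real.rpow_mul (Nat.cast_nonneg N), ← Real.rpow_natCast]
  norm_num

lemma one_le_rpow_three_quarters {N : ℕ} (hN : N ≠ 0) : 1 ≤ (N : ℝ) ^ ((3 : ℝ) / 4) :=
  Real.one_le_rpow (by exact_mod_cast Nat.one_le_iff_ne_zero.2 hN) (by norm_num)

lemma latticePt_pow_four (m : ℝ) {N : ℕ} (hN : N ≠ 0) (k : ℕ) :
    latticePt m N k ^ 4 = N * ((2 * k - N) / N - m) ^ 4 := by
  have hNr : (N : ℝ) ≠ 0 := Nat.cast_ne_zero.2 hN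
  rw [latticePt, div_pow, rpow_three_quarters_pow_four,
    show (2 * (k : ℝ) - N) / N - m = (2 * k - N - N * m) / N by field_simp, div_pow]
  field_simp

lemma sqrt_mul_exp_neg_le {N : ℕ} (hN : N ≠ 0) {η : ℝ} (hη : 0 < η) :
    √N * Real.exp (-(η * N)) ≤ η⁻¹ := by
  have hN1 : (1 : ℝ) ≤ N := by exact_mod_cast Nat.one_le_iff_ne_zero.2 hN
  have h1 : √(N : ℝ) ≤ N := Real.sqrt_le_iff.2 ⟨by positivity, by nlinarith⟩
  have h2 : η * N ≤ Real.exp (η * N) := by linarith [Real.add_one_le_exp (η * N)]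
  rw [Real.exp_neg, ← div_eq_mul_inv, div_le_iff₀ (Real.exp_pos _), inv_mul_eq_div,
    le_div_iff₀ hη]
  nlinarith

lemma levelWeight_nonneg (p : ℕ) (β h m : ℝ) {N k : ℕ} (hk : k ≤ N) :
    0 ≤ levelWeight p β h m N k := by
  have := binPmf_nonneg hk
  unfold levelWeight
  positivity

lemma spin_mean_mem {N k : ℕ} (hN : N ≠ 0) (hk : k ≤ N) :
    (2 * (k : ℝ) - N) / N ∈ Set.Icc (-1 : ℝ) 1 := by
  have hNr : (0 : ℝ) < N := by positivity
  have hk' : (k : ℝ) ≤ N := by exact_mod_cast hk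
  have hk0 : (0 : ℝ) ≤ k := by positivity
  constructor
  · rw [le_div_iff₀ hNr]; linarith
  · rw [div_le_iff₀ hNr]; linarith

lemma exists_levelWeight_le {p : ℕ} {β h m δ : ℝ} (hm : m ∈ Set.Ioo (-1 : ℝ) 1) (hδ : 0 < δ)
    (hH : ∀ x ∈ Set.Icc (-1 : ℝ) 1, Hfun p β h x - Hfun p β h m ≤ -δ * (x - m) ^ 4) :
    ∃ C > 0, ∀ N k : ℕ, N ≠ 0 → k ≤ N →
      levelWeight p β h m N k ≤ C * Real.exp (-(δ / 2) * latticePt m N k ^ 4) := by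
  set ε := (1 - |m|) / 2 with hε
  have hm1 : |m| < 1 := abs_lt.2 hm
  have hε0 : 0 < ε := by rw [hε]; linarith
  obtain ⟨C, hC, hb⟩ := sqrt_mul_binPmf_le (half_pos hε0)
  set η := δ / 2 * ε ^ 4 with hη
  have hη0 : 0 < η := by positivity
  refine ⟨max C η⁻¹, lt_max_of_lt_left hC, fun N k hN hk => ?_⟩
  have hNr : (0 : ℝ) < N := by positivity
  set x := (2 * (k : ℝ) - N) / N with hx
  have hkx : (k : ℝ) / N = (1 + x) / 2 := by rw [hx]; field_simp; ring
  have hT : latticePt m N k ^ 4 = N * (x - m) ^ 4 := latticePt_pow_four m hN k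
  have hexp : (N : ℝ) * (Hfun p β h x - Hfun p β h m) ≤ -δ * latticePt m N k ^ 4 := by
    rw [hT]
    have := mul_le_mul_of_nonneg_left (hH x (spin_mean_mem hN hk)) hNr.le
    linarith
  have hT0 : 0 ≤ latticePt m N k ^ 4 := by positivity
  unfold levelWeight
  rcases lt_or_ge |x - m| ε with hxm | hxm
  · have h1 : √(N : ℝ) * binPmf N k ≤ C := by
      have := abs_lt.1 hxm
      refine hb N k (Nat.pos_of_ne_zero hN) ?_ ?_ <;> rw [hkx]
      · linarith [this.1, neg_abs_le m]
      · linarith [this.2, le_abs_self m]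
    have h2 : (N : ℝ) * (Hfun p β h x - Hfun p β h m) ≤ -(δ / 2) * latticePt m N k ^ 4 := by
      nlinarith
    have := h1.trans (le_max_left C η⁻¹)
    have := hC.trans_le (le_max_left C η⁻¹)
    gcongr
  · have hε4 : ε ^ 4 ≤ (x - m) ^ 4 := by
      rw [← Even.pow_abs (by decide) (x - m)]
      gcongr
    have h2 : (N : ℝ) * (Hfun p β h x - Hfun p β h m) ≤
        -(η * N) + -(δ / 2) * latticePt m N k ^ 4 := by
      refine hexp.trans ?_
      rw [hT, hη]
      nlinarith [mul_le_mul_of_nonneg_left hε4 (by positivity : 0 ≤ δ / 2 * N)]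
    calc √(N : ℝ) * binPmf N k * Real.exp (N * (Hfun p β h x - Hfun p β h m))
        ≤ √(N : ℝ) * 1 * Real.exp (-(η * N) + -(δ / 2) * latticePt m N k ^ 4) := by
          have := binPmf_le_one hk
          gcongr
      _ = √(N : ℝ) * Real.exp (-(η * N)) * Real.exp (-(δ / 2) * latticePt m N k ^ 4) := by
          rw [Real.exp_add]; ring
      _ ≤ max C η⁻¹ * Real.exp (-(δ / 2) * latticePt m N k ^ 4) := by
          have := (sqrt_mul_exp_neg_le hN hη0).trans (le_max_right C η⁻¹)
          gcongr

lemma tendsto_rpow_three_quarters :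
    Tendsto (fun N : ℕ => (N : ℝ) ^ ((3 : ℝ) / 4)) atTop atTop :=
  (tendsto_rpow_atTop (by norm_num)).comp tendsto_natCast_atTop_atTop

lemma tendsto_rpow_three_quarters_div :
    Tendsto (fun N : ℕ => (N : ℝ) ^ ((3 : ℝ) / 4) / N) atTop (𝓝 0) := by
  have h : Tendsto (fun N : ℕ => (N : ℝ) ^ (-(1 / 4 : ℝ))) atTop (𝓝 0) :=
    (tendsto_rpow_neg_atTop (by norm_num)).comp tendsto_natCast_atTop_atTop
  refine h.congr' ?_
  filter_upwards [eventually_gt_atTop 0] with N hN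
  have hNr : (0 : ℝ) < N := by positivity
  rw [← Real.rpow_sub_one hNr.ne']
  norm_num

lemma tendsto_levelWeight {p : ℕ} {β h m c t : ℝ} (hm : m ∈ Set.Ioo (-1 : ℝ) 1)
    (ho : (fun x => Hfun p β h x - Hfun p β h m - c * (x - m) ^ 4)
      =o[𝓝 m] fun x => (x - m) ^ 4) {k : ℕ → ℕ}
    (hk : Tendsto (fun N => latticePt m N (k N)) atTop (𝓝 t)) :
    Tendsto (fun N => levelWeight p β h m N (k N)) atTop
      (𝓝 (√π / (√π * √π) / √(2 * ((1 + m) / 2) * (1 - (1 + m) / 2)) * Real.exp (c * t ^ 4))) := by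
  have hx : Tendsto (fun N : ℕ => (2 * (k N : ℝ) - N) / N) atTop (𝓝 m) := by
    have h1 := (hk.mul tendsto_rpow_three_quarters_div).add_const m
    rw [mul_zero, zero_add] at h1
    refine h1.congr' ?_
    filter_upwards [eventually_gt_atTop 0] with N hN
    have hNr : (0 : ℝ) < N := by positivity
    have hr : (0 : ℝ) < (N : ℝ) ^ ((3 : ℝ) / 4) := by positivity
    rw [latticePt]
    field_simp
    ring
  have hkN : Tendsto (fun N : ℕ => (k N : ℝ) / N) atTop (𝓝 ((1 + m) / 2)) := by
    refine ((hx.const_add 1).div_const 2).congr' ?_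
    filter_upwards [eventually_gt_atTop 0] with N hN
    have hNr : (0 : ℝ) < N := by positivity
    field_simp
    ring
  have hα : (1 + m) / 2 ∈ Set.Ioo (0 : ℝ) 1 := ⟨by linarith [hm.1], by linarith [hm.2]⟩
  refine (tendsto_sqrt_mul_binPmf hα hkN).mul ((Real.continuous_exp.tendsto _).comp ?_)
  have ho' := (ho.comp_tendsto hx).tendsto_div_nhds_zero
  have h2 := (ho'.mul (hk.pow 4)).add ((hk.pow 4).const_mul c)
  rw [zero_mul, zero_add] at h2
  refine h2.congr' ?_
  filter_upwards [eventually_ne_atTop 0] with N hN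
  have hNr : (N : ℝ) ≠ 0 := Nat.cast_ne_zero.2 hN
  simp only [Function.comp]
  rw [latticePt_pow_four m hN]
  set x := (2 * (k N : ℝ) - N) / N
  by_cases hxm : x - m = 0
  · rw [sub_eq_zero.1 hxm]; simp
  · field_simp
    ring

/-- The lattice coordinate in which `k ≤ latticeCoord m N t < k + 1` means that `t` lies between
`latticePt m N k` and `latticePt m N (k + 1)`. -/
def latticeCoord (m : ℝ) (N : ℕ) (t : ℝ) : ℝ :=
  (N : ℝ) ^ ((3 : ℝ) / 4) / 2 * t + N * ((1 + m) / 2)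

lemma latticePt_mem (m : ℝ) {N k : ℕ} (hN : N ≠ 0) {t : ℝ} (h1 : (k : ℝ) ≤ latticeCoord m N t)
    (h2 : latticeCoord m N t < k + 1) :
    latticePt m N k ∈ Set.Icc (t - 2 / (N : ℝ) ^ ((3 : ℝ) / 4)) t := by
  have hr := one_le_rpow_three_quarters hN
  unfold latticeCoord at h1 h2
  unfold latticePt
  set r := (N : ℝ) ^ ((3 : ℝ) / 4)
  have hr0 : 0 < r := by linarith
  constructor
  · rw [sub_le_iff_le_add, ← add_div, le_div_iff₀ hr0]
    linarith
  · rw [div_le_iff₀ hr0]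
    linarith

lemma eventually_latticeCoord {m : ℝ} (hm : m ∈ Set.Ioo (-1 : ℝ) 1) (t : ℝ) :
    ∀ᶠ N : ℕ in atTop, 0 ≤ latticeCoord m N t ∧ ⌊latticeCoord m N t⌋₊ ≤ N := by
  have h1 : Tendsto (fun N : ℕ => latticeCoord m N t / N) atTop (𝓝 ((1 + m) / 2)) := by
    have h := (tendsto_rpow_three_quarters_div.mul_const (t / 2)).add_const ((1 + m) / 2)
    rw [zero_mul, zero_add] at h
    refine h.congr' ?_
    filter_upwards [eventually_gt_atTop 0] with N hN
    have hNr : (0 : ℝ) < N := by positivity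
    rw [latticeCoord]
    field_simp
  have hα : (1 + m) / 2 ∈ Set.Ioo (0 : ℝ) 1 := ⟨by linarith [hm.1], by linarith [hm.2]⟩
  filter_upwards [h1.eventually (isOpen_Ioo.mem_nhds hα), eventually_gt_atTop 0] with N h hN
  have hNr : (0 : ℝ) < N := by positivity
  have h2 := (div_lt_one hNr).1 h.2
  have h3 := (div_pos_iff_of_pos_right hNr).1 h.1
  exact ⟨h3.le, Nat.floor_le_of_le h2.le⟩

lemma tendsto_latticePt_floor {m : ℝ} (hm : m ∈ Set.Ioo (-1 : ℝ) 1) (t : ℝ) :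
    Tendsto (fun N => latticePt m N ⌊latticeCoord m N t⌋₊) atTop (𝓝 t) := by
  have h1 : Tendsto (fun N : ℕ => t - 2 / (N : ℝ) ^ ((3 : ℝ) / 4)) atTop (𝓝 t) := by
    simpa using (tendsto_rpow_three_quarters.const_div_atTop 2).const_sub t
  have hmem : ∀ᶠ N : ℕ in atTop, latticePt m N ⌊latticeCoord m N t⌋₊ ∈
      Set.Icc (t - 2 / (N : ℝ) ^ ((3 : ℝ) / 4)) t := by
    filter_upwards [eventually_latticeCoord hm t, eventually_ne_atTop 0] with N h hN
    exact latticePt_mem m hN (Nat.floor_le h.1) (Nat.lt_floor_add_one _)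
  exact tendsto_of_tendsto_of_tendsto_of_le_of_le' h1 tendsto_const_nhds
    (hmem.mono fun _ h => h.1) (hmem.mono fun _ h => h.2)

lemma exp_neg_latticePt_le {m δ : ℝ} (hδ : 0 < δ) {N k : ℕ} (hN : N ≠ 0) {t : ℝ}
    (h1 : (k : ℝ) ≤ latticeCoord m N t) (h2 : latticeCoord m N t < k + 1) :
    Real.exp (-δ * latticePt m N k ^ 4) ≤ Real.exp (16 * δ) * Real.exp (-(δ / 8) * t ^ 4) := by
  have hmem := latticePt_mem m hN h1 h2
  have hr := one_le_rpow_three_quarters hN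
  have h3 : 2 / (N : ℝ) ^ ((3 : ℝ) / 4) ≤ 2 := div_le_self (by norm_num) hr
  set s := latticePt m N k
  set y := t - s with hy
  have hy0 : 0 ≤ y := by linarith [hmem.2]
  have hy2 : y ≤ 2 := by linarith [hmem.1]
  have hy4 : y ^ 4 ≤ 2 ^ 4 := by gcongr
  have key : t ^ 4 ≤ 8 * s ^ 4 + 8 * y ^ 4 := by
    have : t = s + y := by rw [hy]; ring
    have hs : (s + y) ^ 2 ≤ 2 * (s ^ 2 + y ^ 2) := by nlinarith [sq_nonneg (s - y)]
    calc t ^ 4 = ((s + y) ^ 2) ^ 2 := by rw [this]; ring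
      _ ≤ (2 * (s ^ 2 + y ^ 2)) ^ 2 := by gcongr
      _ ≤ 8 * s ^ 4 + 8 * y ^ 4 := by nlinarith [sq_nonneg (s ^ 2 - y ^ 2)]
  rw [← Real.exp_add]
  gcongr
  nlinarith

lemma tendsto_sum_levelWeight {p : ℕ} {β h m c δ : ℝ} (hm : m ∈ Set.Ioo (-1 : ℝ) 1)
    (hδ : 0 < δ)
    (hH : ∀ x ∈ Set.Icc (-1 : ℝ) 1, Hfun p β h x - Hfun p β h m ≤ -δ * (x - m) ^ 4)
    (ho : (fun x => Hfun p β h x - Hfun p β h m - c * (x - m) ^ 4)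
      =o[𝓝 m] fun x => (x - m) ^ 4)
    {χ : ℝ → ℝ} (hχ : ∀ t, |χ t| ≤ 1) (hχc : ∀ᵐ t, ContinuousAt χ t) :
    Tendsto (fun N : ℕ => ((N : ℝ) ^ ((3 : ℝ) / 4) / 2)⁻¹ *
        ∑ k ∈ Finset.range (N + 1), levelWeight p β h m N k * χ (latticePt m N k)) atTop
      (𝓝 (∫ t, √π / (√π * √π) / √(2 * ((1 + m) / 2) * (1 - (1 + m) / 2)) *
        Real.exp (c * t ^ 4) * χ t)) := by
  obtain ⟨C, hC, hb⟩ := exists_levelWeight_le hm hδ hH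
  have hlim : Tendsto (fun N : ℕ => ∫ t, stepFn N
      (fun k => levelWeight p β h m N k * χ (latticePt m N k)) (latticeCoord m N t)) atTop
      (𝓝 (∫ t, √π / (√π * √π) / √(2 * ((1 + m) / 2) * (1 - (1 + m) / 2)) *
        Real.exp (c * t ^ 4) * χ t)) := by
    refine tendsto_integral_filter_of_dominated_convergence
      (fun t => C * (Real.exp (16 * (δ / 2)) * Real.exp (-(δ / 2 / 8) * t ^ 4))) ?_ ?_ ?_ ?_
    · refine Eventually.of_forall fun N => ((measurable_stepFn N _).comp ?_).aestronglyMeasurable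
      unfold latticeCoord
      fun_prop
    · filter_upwards [eventually_ne_atTop 0] with N hN
      refine Eventually.of_forall fun t => ?_
      rw [Real.norm_eq_abs]
      refine abs_stepFn_le (by positivity) fun k hk h1 h2 => ?_
      rw [abs_mul, abs_of_nonneg (levelWeight_nonneg p β h m hk)]
      calc levelWeight p β h m N k * |χ (latticePt m N k)|
          ≤ levelWeight p β h m N k * 1 :=
            mul_le_mul_of_nonneg_left (hχ _) (levelWeight_nonneg p β h m hk)
        _ ≤ C * Real.exp (-(δ / 2) * latticePt m N k ^ 4) := by
            rw [mul_one]; exact hb N k hN hk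
        _ ≤ _ := by
            gcongr
            exact exp_neg_latticePt_le (half_pos hδ) hN h1 h2
    · exact ((integrable_exp_neg_mul_four (by positivity)).const_mul _).const_mul _
    · filter_upwards [hχc] with t ht
      have hT := tendsto_latticePt_floor hm t
      refine ((tendsto_levelWeight hm ho hT).mul (ht.tendsto.comp hT)).congr' ?_
      filter_upwards [eventually_latticeCoord hm t] with N hN
      rw [stepFn_floor _ hN.1 hN.2]
      rfl
  refine hlim.congr' ?_
  filter_upwards [eventually_gt_atTop 0] with N hN
  have hNr : (0 : ℝ) < N := by positivity
  exact integral_stepFn_comp N _ (by positivity) _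

lemma sum_mul_cwWeight_eq_levelWeight {p N : ℕ} (hN : N ≠ 0) (β h m : ℝ) (χ : ℝ → ℝ) :
    ∑ σ : Fin N → Bool, χ ((mag σ - N * m) / (N : ℝ) ^ ((3 : ℝ) / 4)) * cwWeight p N β h σ =
      2 ^ N * Real.exp (N * Hfun p β h m) / √N *
        ∑ k ∈ Finset.range (N + 1), levelWeight p β h m N k * χ (latticePt m N k) := by
  have hNr : (0 : ℝ) < N := by positivity
  have hs : 0 < √(N : ℝ) := Real.sqrt_pos.2 hNr
  rw [sum_mul_cwWeight hN β h fun s => χ ((s - N * m) / (N : ℝ) ^ ((3 : ℝ) / 4)), Finset.mul_sum]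
  refine Finset.sum_congr rfl fun k _ => ?_
  rw [levelWeight, latticePt, mul_sub, Real.exp_sub]
  have := Real.exp_pos (N * Hfun p β h m)
  field_simp

lemma cwProb_eq {p N : ℕ} (hN : N ≠ 0) (β h m : ℝ) (S : Set ℝ) :
    cwProb p N β h {σ | (mag σ - N * m) / (N : ℝ) ^ ((3 : ℝ) / 4) ∈ S} =
      (((N : ℝ) ^ ((3 : ℝ) / 4) / 2)⁻¹ * ∑ k ∈ Finset.range (N + 1),
          levelWeight p β h m N k * S.indicator (fun _ => 1) (latticePt m N k)) /
        (((N : ℝ) ^ ((3 : ℝ) / 4) / 2)⁻¹ * ∑ k ∈ Finset.range (N + 1),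
          levelWeight p β h m N k * (fun _ => (1 : ℝ)) (latticePt m N k)) := by
  have hNr : (0 : ℝ) < N := by positivity
  have h1 := sum_mul_cwWeight_eq_levelWeight (p := p) hN β h m (S.indicator fun _ => 1)
  have h2 := sum_mul_cwWeight_eq_levelWeight (p := p) hN β h m fun _ => 1
  have hE : ∑ σ : Fin N → Bool, {σ : Fin N → Bool |
      (mag σ - N * m) / (N : ℝ) ^ ((3 : ℝ) / 4) ∈ S}.indicator (cwWeight p N β h) σ =
      ∑ σ : Fin N → Bool, S.indicator (fun _ => (1 : ℝ))
        ((mag σ - N * m) / (N : ℝ) ^ ((3 : ℝ) / 4)) * cwWeight p N β h σ := by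
    refine Finset.sum_congr rfl fun σ _ => ?_
    by_cases hσ : (mag σ - N * m) / (N : ℝ) ^ ((3 : ℝ) / 4) ∈ S
    · rw [Set.indicator_of_mem hσ, Set.indicator_of_mem (by exact hσ), one_mul]
    · rw [Set.indicator_of_notMem hσ, Set.indicator_of_notMem (by exact hσ), zero_mul]
  simp only [one_mul] at h2
  rw [mul_div_mul_left _ _ (by positivity), cwProb, hE, h1, h2,
    mul_div_mul_left _ _ (by positivity)]

lemma continuousAt_indicator_Iic_one {x t : ℝ} (ht : t ≠ x) :
    ContinuousAt ((Set.Iic x).indicator fun _ => (1 : ℝ)) t := by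
  rcases lt_or_gt_of_ne ht with h | h
  · refine (continuousAt_const (y := (1 : ℝ))).congr ?_
    filter_upwards [Iio_mem_nhds h] with s hs
    rw [Set.indicator_of_mem (Set.mem_Iic.2 (le_of_lt hs))]
  · refine (continuousAt_const (y := (0 : ℝ))).congr ?_
    filter_upwards [Ioi_mem_nhds h] with s hs
    rw [Set.indicator_of_notMem (Set.notMem_Iic.2 hs)]

lemma specialCDF_eq {c : ℝ} (hc : c < 0) (x : ℝ) {L : ℝ} (hL : L ≠ 0) :
    specialCDF c x = (∫ t, L * Real.exp (c / 24 * t ^ 4) * (Set.Iic x).indicator (fun _ => 1) t) /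
      ∫ t, L * Real.exp (c / 24 * t ^ 4) * 1 := by
  have hb : 0 < -c / 24 := by linarith
  have hZ := integral_exp_neg_mul_four hb
  rw [show -(-c / 24) = c / 24 by ring] at hZ
  have hG := Real.Gamma_pos_of_pos (show (0 : ℝ) < 1 / 4 by norm_num)
  have h1 : ∀ t, L * Real.exp (c / 24 * t ^ 4) * (Set.Iic x).indicator (fun _ => 1) t =
      L * (Set.Iic x).indicator (fun t => Real.exp (c / 24 * t ^ 4)) t := by
    intro t
    by_cases ht : t ∈ Set.Iic x <;> simp [ht]
  have h2 : ∀ t : ℝ, Real.exp (c * t ^ 4 / 24) = Real.exp (c / 24 * t ^ 4) := by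
    intro t; congr 1; ring
  simp only [h1, mul_one, specialCDF, h2]
  rw [integral_const_mul, integral_const_mul, integral_const_mul,
    integral_indicator measurableSet_Iic, hZ, mul_div_mul_left _ _ hL, Real.rpow_neg hb.le]
  have : 0 < (-c / 24) ^ ((1 : ℝ) / 4) := by positivity
  field_simp

/-- **Non-Gaussian limit law for the magnetization at `p`-special points.** -/
theorem clt_special
    (p : ℕ) (hp : 3 ≤ p) (β h m : ℝ) (hβ : 0 < β) (hh : 0 < h)
    (hsp : pSpecial p β h m) :
    ∀ x : ℝ,
      Tendsto (fun N : ℕ =>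
          cwProb p N β h {σ | (mag σ - N * m) / (N : ℝ) ^ ((3:ℝ)/4) ≤ x})
        atTop (𝓝 (specialCDF (iteratedDeriv 4 (Hfun p β h) m) x)) := by
  intro x
  obtain ⟨hmax, h2⟩ := hsp
  have hm := hmax.1.1
  rw [(iteratedDeriv_Hfun p β h hm).1] at h2
  rw [(iteratedDeriv_Hfun p β h hm).2]
  obtain ⟨h1, h3⟩ := hmax.1.derivs h2
  have h4 := Hderiv₄_neg hp hm h2 h3
  have ho := Hfun_isLittleO_four hm h1 h2 h3
  obtain ⟨δ, hδ, hH⟩ := exists_quartic_bound (continuous_Hfun p β h) (Set.Ioo_subset_Icc_self hm)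
    (fun y hy hym => hmax.lt hβ hh hy hym) (by linarith) ho
  have hα : 0 < 2 * ((1 + m) / 2) * (1 - (1 + m) / 2) :=
    mul_pos (by linarith [hm.1]) (by linarith [hm.2])
  have hL : √π / (√π * √π) / √(2 * ((1 + m) / 2) * (1 - (1 + m) / 2)) ≠ 0 := by
    have := Real.sqrt_pos.2 hα
    positivity
  rw [specialCDF_eq h4 x hL]
  have hnum := tendsto_sum_levelWeight hm hδ hH ho
    (χ := (Set.Iic x).indicator fun _ => 1)
    (fun t => by by_cases ht : t ∈ Set.Iic x <;> simp [ht]) (by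
      filter_upwards [compl_mem_ae_iff.2 (measure_singleton x)] with t ht
      exact continuousAt_indicator_Iic_one ht)
  have hden := tendsto_sum_levelWeight hm hδ hH ho (χ := fun _ => 1) (fun t => by simp)
    (Eventually.of_forall fun t => continuousAt_const)
  refine (hnum.div hden ?_).congr' ?_
  · have := integral_exp_neg_mul_four_pos (b := -(Hderiv₄ p β m / 24)) (by linarith)
    rw [neg_neg] at this
    simp only [mul_one]
    rw [integral_const_mul]
    exact mul_ne_zero hL this.ne'
  · filter_upwards [eventually_ne_atTop 0] with N hN
    exact (cwProb_eq hN β h m (Set.Iic x)).symm
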